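/- arXiv:2504.09126 — 2 statements merged into one kernel-verified Lean document; each statement's English description precedes it below -/
import Mathlib

section
/- If the code C is Euclidean LCD, then the polynomial g = gcd(g11, g22) is self-reciprocal. -/
open Polynomial

noncomputable section

/-- The coefficient vector (of length `m`) of the canonical representative of an
element of `R = F[x]/(x^m - 1)`.  Under the identification of `R²` with `F^{2m}` a pair
`(a(x), b(x))` corresponds to the concatenation of the two coefficient vectors. -/
def qcToVec {F : Type} [Field F] {m : ℕ} (hm : 0 < m)
    (a : AdjoinRoot (X ^ m - 1 : F[X])) : Fin m → F := fun i =>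
  (AdjoinRoot.modByMonicHom
    (show (X ^ m - 1 : F[X]).Monic by
      simpa using monic_X_pow_sub_C (1 : F) hm.ne') a).coeff i

/-- The Euclidean inner product `⟨u,v⟩_e = Σ u_i v_i` on `R × R`, via the identification
of `R²` with `F^{2m}` by coefficient vectors. -/
def qcEuclInner {F : Type} [Field F] {m : ℕ} (hm : 0 < m)
    (u v : AdjoinRoot (X ^ m - 1 : F[X]) × AdjoinRoot (X ^ m - 1 : F[X])) : F :=
  (∑ i, qcToVec hm u.1 i * qcToVec hm v.1 i) +
    ∑ i, qcToVec hm u.2 i * qcToVec hm v.2 i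

/-- A code `C ⊆ R²` is LCD with respect to a pairing `inner` if it meets its dual
trivially, i.e. `C ∩ C^⊥ = {0}` where `C^⊥ = {v : ∀ c ∈ C, inner c v = 0}`. -/
def IsLCDWith {F : Type} [Field F] {m : ℕ}
    (Cd : Submodule (AdjoinRoot (X ^ m - 1 : F[X]))
      (AdjoinRoot (X ^ m - 1 : F[X]) × AdjoinRoot (X ^ m - 1 : F[X])))
    (inner : (AdjoinRoot (X ^ m - 1 : F[X]) × AdjoinRoot (X ^ m - 1 : F[X])) →
      (AdjoinRoot (X ^ m - 1 : F[X]) × AdjoinRoot (X ^ m - 1 : F[X])) → F) : Prop :=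
  ∀ v ∈ Cd, (∀ c ∈ Cd, inner c v = 0) → v = 0

/-- `f` is self-reciprocal: the reciprocal polynomial `f*(x) = x^(deg f)·f(1/x)` is a
nonzero scalar multiple of `f`. -/
def IsSelfReciprocal {F : Type} [Field F] (f : F[X]) : Prop :=
  ∃ α : F, α ≠ 0 ∧ f.reverse = Polynomial.C α * f

/-- The canonical representative of `r x^n` in `F[x]/(x^m - 1)` is `r x^(n mod m)`. -/
theorem qcToVec_mk_monomial {F : Type} [Field F] {m : ℕ} (hm : 0 < m) (n : ℕ) (r : F)
    (i : Fin m) :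
    qcToVec hm (AdjoinRoot.mk (X ^ m - 1 : F[X]) (monomial n r)) i =
      if n % m = i then r else 0 := by
  have hmonic : (X ^ m - 1 : F[X]).Monic := by
    simpa using monic_X_pow_sub_C (1 : F) hm.ne'
  have hdeg : (X ^ m - 1 : F[X]).degree = m := by
    simpa using degree_X_pow_sub_C hm (1 : F)
  have hmod : (monomial n r : F[X]) %ₘ (X ^ m - 1) = monomial (n % m) r := by
    obtain ⟨k, hk⟩ : (X ^ m - 1 : F[X]) ∣ (X ^ m) ^ (n / m) - 1 := sub_one_dvd_pow_sub_one _ _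
    refine (div_modByMonic_unique (C r * X ^ (n % m) * k) _ hmonic ⟨?_, ?_⟩).2
    · rw [mul_left_comm, ← hk, ← C_mul_X_pow_eq_monomial, ← C_mul_X_pow_eq_monomial]
      conv_rhs => rw [← Nat.mod_add_div n m, pow_add, pow_mul]
      ring
    · rw [hdeg]
      exact (degree_monomial_le _ _).trans_lt (by exact_mod_cast Nat.mod_lt n hm)
  rw [qcToVec, AdjoinRoot.modByMonicHom_mk, hmod, coeff_monomial]

/-- The Euclidean inner product of coefficient vectors, as a bilinear form on
`F[x]/(x^m - 1)`. -/
def qcDot {F : Type} [Field F] {m : ℕ} (hm : 0 < m)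
    (a b : AdjoinRoot (X ^ m - 1 : F[X])) : F :=
  ∑ i, qcToVec hm a i * qcToVec hm b i

theorem qcDot_add_left {F : Type} [Field F] {m : ℕ} (hm : 0 < m)
    (a a' b : AdjoinRoot (X ^ m - 1 : F[X])) :
    qcDot hm (a + a') b = qcDot hm a b + qcDot hm a' b := by
  simp [qcDot, qcToVec, add_mul, Finset.sum_add_distrib]

theorem qcDot_add_right {F : Type} [Field F] {m : ℕ} (hm : 0 < m)
    (a b b' : AdjoinRoot (X ^ m - 1 : F[X])) :
    qcDot hm a (b + b') = qcDot hm a b + qcDot hm a b' := by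
  simp [qcDot, qcToVec, mul_add, Finset.sum_add_distrib]

theorem qcDot_zero_left {F : Type} [Field F] {m : ℕ} (hm : 0 < m)
    (b : AdjoinRoot (X ^ m - 1 : F[X])) : qcDot hm 0 b = 0 := by
  simp [qcDot, qcToVec]

theorem qcDot_zero_right {F : Type} [Field F] {m : ℕ} (hm : 0 < m)
    (a : AdjoinRoot (X ^ m - 1 : F[X])) : qcDot hm a 0 = 0 := by
  simp [qcDot, qcToVec]

theorem qcDot_mk_monomial {F : Type} [Field F] {m : ℕ} (hm : 0 < m) (n k : ℕ) (r s : F) :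
    qcDot hm (AdjoinRoot.mk _ (monomial n r)) (AdjoinRoot.mk _ (monomial k s)) =
      if n ≡ k [MOD m] then r * s else 0 := by
  simp only [qcDot, qcToVec_mk_monomial]
  rw [Finset.sum_eq_single ⟨n % m, Nat.mod_lt n hm⟩]
  · simp only [Nat.ModEq, if_true, mul_ite, mul_zero, eq_comm]
    congr
  · intro i _ hi
    rw [if_neg fun h => hi (Fin.ext h.symm), zero_mul]
  · simp

/-- Multiplying the first argument by `c x^i` is adjoint, up to a shift by `x^N`, to
multiplying the second by `c x^(N-i)`. -/
theorem qcDot_mk_monomial_mul {F : Type} [Field F] {m : ℕ} (hm : 0 < m) {i j N : ℕ}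
    (hij : i + j = N) (c : F) (a b : AdjoinRoot (X ^ m - 1 : F[X])) :
    qcDot hm a (AdjoinRoot.mk _ (monomial j c) * b) =
      qcDot hm (AdjoinRoot.mk _ (monomial i c) * a) (AdjoinRoot.mk _ (X ^ N) * b) := by
  obtain ⟨p, rfl⟩ := AdjoinRoot.mk_surjective a
  obtain ⟨q, rfl⟩ := AdjoinRoot.mk_surjective b
  induction p using Polynomial.induction_on' with
  | add p p' hp hp' => simp only [map_add, mul_add, qcDot_add_left, hp, hp']
  | monomial n r =>
    induction q using Polynomial.induction_on' with
    | add q q' hq hq' => simp only [map_add, mul_add, qcDot_add_right, hq, hq']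
    | monomial k s =>
      simp only [← map_mul, X_pow_eq_monomial, monomial_mul_monomial, qcDot_mk_monomial]
      have : n ≡ j + k [MOD m] ↔ i + n ≡ N + k [MOD m] := by
        subst hij
        rw [add_assoc]
        exact ⟨Nat.ModEq.add_left i, Nat.ModEq.add_left_cancel' i⟩
      simp only [this]
      congr 1
      ring

/-- Multiplication by a reflected polynomial is adjoint, up to a shift, to multiplication by
the polynomial. -/
theorem qcDot_mk_reflect_mul {F : Type} [Field F] {m : ℕ} (hm : 0 < m) (N : ℕ)
    (p : F[X]) (hp : p.natDegree ≤ N) (a b : AdjoinRoot (X ^ m - 1 : F[X])) :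
    qcDot hm a (AdjoinRoot.mk _ (p.reflect N) * b) =
      qcDot hm (AdjoinRoot.mk _ p * a) (AdjoinRoot.mk _ (X ^ N) * b) := by
  refine induction_with_natDegree_le (fun p => qcDot hm a (AdjoinRoot.mk _ (p.reflect N) * b) =
    qcDot hm (AdjoinRoot.mk _ p * a) (AdjoinRoot.mk _ (X ^ N) * b)) N ?_ ?_ ?_ p hp
  · simp [qcDot_zero_left, qcDot_zero_right]
  · intro i c _ hi
    rw [reflect_C_mul_X_pow, revAt_le hi, C_mul_X_pow_eq_monomial, C_mul_X_pow_eq_monomial]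
    exact qcDot_mk_monomial_mul hm (Nat.add_sub_cancel' hi) c a b
  · intro f g _ _ hf hg
    simp only [reflect_add, map_add, add_mul, qcDot_add_left, qcDot_add_right]
    rw [hf, hg]

theorem reverse_X_pow_sub_one {F : Type} [Field F] (m : ℕ) :
    (X ^ m - 1 : F[X]).reverse = -(X ^ m - 1) := by
  have hdeg : (X ^ m - 1 : F[X]).natDegree = m := by
    simpa using natDegree_X_pow_sub_C (n := m) (r := (1 : F))
  rw [reverse, hdeg, reflect_sub, reflect_one, ← one_mul (X ^ m), ← C_1,
    reflect_C_mul_X_pow, revAt_le le_rfl]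
  simp

/-- A nonzero polynomial that divides its reciprocal is self-reciprocal. -/
theorem isSelfReciprocal_of_dvd_reverse {F : Type} [Field F] {f : F[X]} (hf : f ≠ 0)
    (h : f ∣ f.reverse) : IsSelfReciprocal f := by
  obtain ⟨k, hk⟩ := h
  have hr : f.reverse ≠ 0 := by simpa using hf
  have hk0 : k ≠ 0 := by rintro rfl; simp_all
  have hd := reverse_natDegree_le f
  rw [hk, natDegree_mul hf hk0] at hd
  obtain ⟨c, rfl⟩ := natDegree_eq_zero.1 (show k.natDegree = 0 by omega)
  exact ⟨c, by simpa using hk0, by rw [hk, mul_comm]⟩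

/-- The cofactor in `x^m - 1` of a self-reciprocal polynomial is self-reciprocal. -/
theorem IsSelfReciprocal.of_mul_eq_X_pow_sub_one {F : Type} [Field F] {m : ℕ} (hm : 0 < m)
    {g h : F[X]} (hgh : X ^ m - 1 = g * h) (hh : IsSelfReciprocal h) : IsSelfReciprocal g := by
  obtain ⟨α, hα, hrev⟩ := hh
  have hh0 : h ≠ 0 := by
    rintro rfl
    exact X_pow_sub_C_ne_zero hm (1 : F) (by simpa using hgh)
  refine ⟨-α⁻¹, by simpa using hα, mul_right_cancel₀ hh0 ?_⟩
  have key := reverse_X_pow_sub_one (F := F) m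
  rw [hgh, reverse_mul_of_domain, hrev] at key
  have hC : (C α⁻¹ * C α : F[X]) = 1 := by rw [← C_mul, inv_mul_cancel₀ hα, C_1]
  rw [C_neg]
  linear_combination C α⁻¹ * key - g.reverse * h * hC

theorem natCast_ne_zero_of_coprime_card {F : Type} [Field F] [Fintype F] {m : ℕ}
    (hqm : Nat.Coprime (Fintype.card F) m) : (m : F) ≠ 0 := by
  intro h0
  have hu : IsCoprime ((Fintype.card F : ℤ)) (m : ℤ) := Nat.isCoprime_iff_coprime.2 hqm
  obtain ⟨a, b, hab⟩ := hu
  have := congrArg (Int.cast : ℤ → F) hab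
  simp [h0] at this

/-- If the quasi-cyclic code `C = ⟨(g11, g12), (0, g22)⟩` is Euclidean LCD, then
`g = gcd(g11, g22)` is self-reciprocal. -/
theorem stmt4 (F : Type) [Field F] [Fintype F] [DecidableEq F] (m : ℕ) (hm : 0 < m)
    (hqm : Nat.Coprime (Fintype.card F) m)
    (g11 g12 g22 : F[X])
    (h1 : g11 ∣ X ^ m - 1) (h2 : g22 ∣ X ^ m - 1)
    (h3 : g12.degree < g22.degree) (h4 : g11 * g22 ∣ (X ^ m - 1) * g12)
    (hlcd : IsLCDWith
      (Submodule.span (AdjoinRoot (X ^ m - 1 : F[X]))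
        {(AdjoinRoot.mk (X ^ m - 1 : F[X]) g11, AdjoinRoot.mk (X ^ m - 1 : F[X]) g12), (0, AdjoinRoot.mk (X ^ m - 1 : F[X]) g22)})
      (qcEuclInner hm)) :
    IsSelfReciprocal (gcd g11 g22) := by
  classical
  set g := gcd g11 g22 with hg
  set n : F[X] := X ^ m - 1 with hn
  obtain ⟨h, hgh⟩ : g ∣ n := (gcd_dvd_left g11 g22).trans h1
  have hn0 : n ≠ 0 := by simpa using X_pow_sub_C_ne_zero hm (1 : F)
  have hg0 : g ≠ 0 := left_ne_zero_of_mul (hgh ▸ hn0)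
  have hh0 : h ≠ 0 := right_ne_zero_of_mul (hgh ▸ hn0)
  have hcop : IsCoprime g h := by
    have hsep : n.Separable := X_pow_sub_one_separable_iff.2 (natCast_ne_zero_of_coprime_card hqm)
    rw [hgh] at hsep
    exact hsep.isCoprime
  have hg12 : g ∣ g12 := by
    have hdvd := (mul_dvd_mul (gcd_dvd_left g11 g22) (gcd_dvd_right g11 g22)).trans h4
    rw [← hg, hgh, mul_assoc] at hdvd
    exact hcop.dvd_of_dvd_mul_left ((mul_dvd_mul_iff_left hg0).1 hdvd)
  have hkill : ∀ p : F[X], g ∣ p → AdjoinRoot.mk n h * AdjoinRoot.mk n p = 0 := by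
    rintro _ ⟨p, rfl⟩
    rw [← map_mul, AdjoinRoot.mk_eq_zero, hgh]
    exact ⟨p, by ring⟩
  set Cd := Submodule.span (AdjoinRoot n)
    {(AdjoinRoot.mk n g11, AdjoinRoot.mk n g12), (0, AdjoinRoot.mk n g22)} with hCd
  have hC : ∀ c ∈ Cd, AdjoinRoot.mk n h • c = 0 := by
    suffices Cd ≤ LinearMap.ker (LinearMap.lsmul (AdjoinRoot n) _ (AdjoinRoot.mk n h)) from
      fun c hc => this hc
    rw [hCd, Submodule.span_le]
    rintro c (rfl | rfl)
    · exact Prod.ext (hkill _ (gcd_dvd_left _ _)) (hkill _ hg12)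
    · exact Prod.ext (mul_zero _) (hkill _ (gcd_dvd_right _ _))
  have hrev : ∀ c ∈ Cd, AdjoinRoot.mk n h.reverse • c = 0 := by
    intro c hc
    refine hlcd _ (Cd.smul_mem _ hc) fun c' hc' => ?_
    have hz := hC c' hc'
    change qcDot hm c'.1 (AdjoinRoot.mk n (h.reflect _) * c.1) +
      qcDot hm c'.2 (AdjoinRoot.mk n (h.reflect _) * c.2) = 0
    rw [qcDot_mk_reflect_mul hm _ h le_rfl, qcDot_mk_reflect_mul hm _ h le_rfl,
      show AdjoinRoot.mk n h * c'.1 = 0 from congrArg Prod.fst hz,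
      show AdjoinRoot.mk n h * c'.2 = 0 from congrArg Prod.snd hz,
      qcDot_zero_left, qcDot_zero_left, add_zero]
  have hd1 : n ∣ h.reverse * g11 := by
    rw [← AdjoinRoot.mk_eq_zero, map_mul]
    exact congrArg Prod.fst (hrev _ (Submodule.subset_span (Or.inl rfl)))
  have hd2 : n ∣ h.reverse * g22 := by
    rw [← AdjoinRoot.mk_eq_zero, map_mul]
    exact congrArg Prod.snd (hrev _ (Submodule.subset_span (Or.inr rfl)))
  have hd : n ∣ h.reverse * g := (dvd_gcd hd1 hd2).trans (gcd_mul_left' _ _ _).dvd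
  rw [hgh, mul_comm g h] at hd
  exact (isSelfReciprocal_of_dvd_reverse hh0
    ((mul_dvd_mul_iff_right hg0).1 hd)).of_mul_eq_X_pow_sub_one hm hgh
end
end

section
/- Assume that g and l are both self-reciprocal. If gcd(t22(x), g12(x)) ≠ 1, then the code C is not Euclidean LCD. -/
open Polynomial

noncomputable section

lemma root_pow_eq_one {F : Type} [Field F] {m : ℕ} :
    AdjoinRoot.root (X ^ m - 1 : F[X]) ^ m = 1 := by
  have h : AdjoinRoot.mk (X ^ m - 1 : F[X]) (X ^ m - 1) = 0 := AdjoinRoot.mk_self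
  rwa [map_sub, map_pow, AdjoinRoot.mk_X, map_one, sub_eq_zero] at h

/-- The conjugation `x ↦ x⁻¹ = x^(m-1)` on `F[x]/(x^m - 1)`. -/
def qcConj (F : Type) [Field F] (m : ℕ) :
    AdjoinRoot (X ^ m - 1 : F[X]) →ₐ[F] AdjoinRoot (X ^ m - 1 : F[X]) :=
  AdjoinRoot.liftAlgHom (X ^ m - 1 : F[X]) (Algebra.ofId F _)
    (AdjoinRoot.root (X ^ m - 1 : F[X]) ^ (m - 1)) (by
      have h' : (AdjoinRoot.root (X ^ m - 1 : F[X]) ^ (m - 1)) ^ m = 1 := by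
        rw [pow_right_comm, root_pow_eq_one, one_pow]
      simp [h'])

section Conjugation

variable {F : Type} [Field F] {m : ℕ}

lemma qcConj_root :
    qcConj F m (AdjoinRoot.root _) = AdjoinRoot.root (X ^ m - 1 : F[X]) ^ (m - 1) := by
  simp [qcConj]

lemma qcConj_mk (p : F[X]) :
    qcConj F m (AdjoinRoot.mk _ p) = AdjoinRoot.mk (X ^ m - 1 : F[X]) (p.comp (X ^ (m - 1))) := by
  rw [← AdjoinRoot.aeval_eq, ← AdjoinRoot.aeval_eq, ← aeval_algHom_apply, qcConj_root, aeval_comp]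
  simp

lemma qcConj_qcConj (hm : 0 < m) (a : AdjoinRoot (X ^ m - 1 : F[X])) :
    qcConj F m (qcConj F m a) = a := by
  have h : (qcConj F m).comp (qcConj F m) = AlgHom.id F _ := by
    refine AdjoinRoot.algHom_ext ?_
    simp only [AlgHom.comp_apply, qcConj_root, map_pow, AlgHom.id_apply]
    set r := AdjoinRoot.root (X ^ m - 1 : F[X])
    have h1 : r ^ (m - 1) * r = 1 := by
      rw [← pow_succ, Nat.sub_add_cancel hm, root_pow_eq_one]
    calc (r ^ (m - 1)) ^ (m - 1) = (r ^ (m - 1)) ^ (m - 1) * r ^ (m - 1) * r := by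
          rw [mul_assoc, h1, mul_one]
      _ = r := by
          rw [← pow_succ, Nat.sub_add_cancel hm, pow_right_comm, root_pow_eq_one, one_pow, one_mul]
  exact DFunLike.congr_fun h a

lemma monic_X_pow_sub_one (hm : 0 < m) : (X ^ m - 1 : F[X]).Monic := by
  simpa using monic_X_pow_sub_C (1 : F) hm.ne'

lemma natDegree_X_pow_sub_one' : (X ^ m - 1 : F[X]).natDegree = m := by
  simpa using natDegree_X_pow_sub_C (n := m) (r := (1 : F))

/-- The constant coefficient of the canonical representative. -/
def qcConst (F : Type) [Field F] {m : ℕ} (hm : 0 < m) :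
    AdjoinRoot (X ^ m - 1 : F[X]) →ₗ[F] F :=
  (lcoeff F 0).comp (AdjoinRoot.modByMonicHom (monic_X_pow_sub_one hm))

lemma qcConst_root_pow (hm : 0 < m) (n : ℕ) :
    qcConst F hm (AdjoinRoot.root _ ^ n) = if m ∣ n then 1 else 0 := by
  have h1 : AdjoinRoot.root (X ^ m - 1 : F[X]) ^ n = AdjoinRoot.mk _ (X ^ (n % m)) := by
    conv_lhs => rw [← Nat.div_add_mod n m, pow_add, pow_mul, root_pow_eq_one, one_pow, one_mul]
    simp
  have h2 : (X ^ (n % m) : F[X]).degree < (X ^ m - 1 : F[X]).degree := by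
    rw [degree_eq_natDegree (monic_X_pow_sub_one hm).ne_zero, natDegree_X_pow_sub_one', degree_X_pow]
    exact_mod_cast Nat.mod_lt n hm
  rw [h1, qcConst, LinearMap.comp_apply, AdjoinRoot.modByMonicHom_mk,
    (modByMonic_eq_self_iff (monic_X_pow_sub_one hm)).2 h2, lcoeff_apply, coeff_X_pow]
  simp [Nat.dvd_iff_mod_eq_zero, eq_comm]

lemma eq_sum_qcToVec (hm : 0 < m) (a : AdjoinRoot (X ^ m - 1 : F[X])) :
    a = ∑ i, qcToVec hm a i • AdjoinRoot.root (X ^ m - 1 : F[X]) ^ (i : ℕ) := by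
  have hM := monic_X_pow_sub_one (F := F) hm
  obtain ⟨p, rfl⟩ := AdjoinRoot.mk_surjective a
  have hd : (p %ₘ (X ^ m - 1)).natDegree < m := by
    have h := natDegree_modByMonic_lt p hM (fun h => by
      have := natDegree_X_pow_sub_one' (F := F) (m := m)
      rw [h, natDegree_one] at this
      omega)
    rwa [natDegree_X_pow_sub_one'] at h
  have hp : AdjoinRoot.mk (X ^ m - 1 : F[X]) p = AdjoinRoot.mk _ (p %ₘ (X ^ m - 1)) := by
    rw [← AdjoinRoot.modByMonicHom_mk hM p, AdjoinRoot.mk_leftInverse hM]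
  conv_lhs => rw [hp, as_sum_range' _ m hd, ← Fin.sum_univ_eq_sum_range, map_sum]
  refine Finset.sum_congr rfl fun i _ => ?_
  rw [qcToVec, AdjoinRoot.modByMonicHom_mk, ← C_mul_X_pow_eq_monomial, map_mul, map_pow,
    AdjoinRoot.mk_X, AdjoinRoot.mk_C, Algebra.smul_def]
  rfl

lemma dvd_add_pred_mul_iff (hm : 0 < m) (i j : Fin m) :
    m ∣ (i : ℕ) + (m - 1) * j ↔ i = j := by
  have h : ((i + (m - 1) * j : ℕ) : ℤ) = m * j + ((i : ℤ) - j) := by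
    push_cast [Nat.cast_sub (Nat.succ_le_of_lt hm)]; ring
  rw [← Int.natCast_dvd_natCast, h, dvd_add_right (dvd_mul_right _ _), Fin.ext_iff]
  constructor
  · intro hd
    have := Int.eq_zero_of_abs_lt_dvd hd (by rw [abs_lt]; omega)
    omega
  · intro hd
    simp [hd]

lemma sum_qcToVec_mul (hm : 0 < m) (a b : AdjoinRoot (X ^ m - 1 : F[X])) :
    ∑ i, qcToVec hm a i * qcToVec hm b i = qcConst F hm (a * qcConj F m b) := by
  conv_rhs => rw [eq_sum_qcToVec hm a, eq_sum_qcToVec hm b]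
  simp only [map_sum, map_smul, map_pow, qcConj_root, Finset.sum_mul_sum, smul_mul_smul_comm,
    ← pow_mul, ← pow_add, qcConst_root_pow]
  simp [dvd_add_pred_mul_iff hm]

end Conjugation

lemma Polynomial.aeval_reverse_eq_zero_of_aeval_inv {F K : Type} [Field F] [Field K] [Algebra F K]
    {f : F[X]} {x : K} (hx : x ≠ 0) (h : aeval x⁻¹ f = 0) : aeval x f.reverse = 0 := by
  let _ := invertibleOfNonzero (inv_ne_zero hx)
  have h2 := (eval₂_reverse_eq_zero_iff (algebraMap F K) x⁻¹ f).2 h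
  rwa [invOf_eq_inv, inv_inv] at h2

lemma IsSelfReciprocal.aeval_inv_ne_zero {F K : Type} [Field F] [Field K] [Algebra F K] {f : F[X]}
    (hf : IsSelfReciprocal f) {x : K} (hx : x ≠ 0) (h : aeval x f ≠ 0) : aeval x⁻¹ f ≠ 0 := by
  obtain ⟨α, hα, h'⟩ := hf
  intro h0
  have h1 := aeval_reverse_eq_zero_of_aeval_inv hx h0
  rw [h', map_mul, aeval_C] at h1
  exact (mul_ne_zero (by simpa using hα) h) h1

lemma Polynomial.Separable.aeval_ne_zero_of_mul {F K : Type} [Field F] [Field K] [Algebra F K]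
    {p q : F[X]} (h : (p * q).Separable) {x : K} (hp : aeval x p = 0) : aeval x q ≠ 0 := by
  obtain ⟨a, b, hab⟩ := h.isCoprime
  intro hq
  simpa [hp, hq] using congrArg (aeval x) hab

/-- The code `⟨(g11, g12), (0, g22)⟩` is not Euclidean LCD if some root `θ` of `x^m - 1` and of
`g12` is not a root of `g11` although `θ⁻¹` is. -/
lemma not_isLCDWith_of_root {F K : Type} [Field F] [Field K] [Algebra F K] {m : ℕ} (hm : 0 < m)
    {g11 g12 g22 : F[X]} {θ : K} (hθ : θ ^ m = 1) (h12 : aeval θ g12 = 0)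
    (h11 : aeval θ g11 ≠ 0) (h11' : aeval θ⁻¹ g11 = 0) :
    ¬ IsLCDWith
      (Submodule.span (AdjoinRoot (X ^ m - 1 : F[X]))
        {(AdjoinRoot.mk (X ^ m - 1 : F[X]) g11, AdjoinRoot.mk (X ^ m - 1 : F[X]) g12),
          (0, AdjoinRoot.mk (X ^ m - 1 : F[X]) g22)})
      (qcEuclInner hm) := by
  intro hL
  have hθ1 : θ ^ (m - 1) = θ⁻¹ := by
    refine eq_inv_of_mul_eq_one_left ?_
    rw [← pow_succ, Nat.sub_add_cancel hm, hθ]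
  obtain ⟨h, hh⟩ : minpoly F θ ∣ X ^ m - 1 := minpoly.dvd _ _ (by simp [hθ])
  have hh0 : h ≠ 0 := by
    rintro rfl
    exact (monic_X_pow_sub_one hm).ne_zero (by rw [hh, mul_zero])
  have key : ∀ p : F[X], aeval θ p = 0 ↔
      AdjoinRoot.mk (X ^ m - 1 : F[X]) h * AdjoinRoot.mk _ p = 0 := by
    intro p
    rw [← map_mul, AdjoinRoot.mk_eq_zero, hh, mul_comm h p, mul_dvd_mul_iff_right hh0,
      minpoly.dvd_iff]
  have hconj : qcConj F m (AdjoinRoot.mk _ h) * AdjoinRoot.mk _ g11 = 0 := by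
    have h0 : AdjoinRoot.mk (X ^ m - 1 : F[X]) h * qcConj F m (AdjoinRoot.mk _ g11) = 0 := by
      rw [qcConj_mk, ← key, aeval_comp]
      simpa [hθ1] using h11'
    simpa [qcConj_qcConj hm] using congrArg (qcConj F m) h0
  have hv := hL (AdjoinRoot.mk _ h • (AdjoinRoot.mk _ g11, AdjoinRoot.mk _ g12))
    (Submodule.smul_mem _ _ (Submodule.subset_span (by simp))) ?_
  · exact h11 ((key g11).2 (congrArg Prod.fst hv))
  · intro c hc
    obtain ⟨a, b, rfl⟩ := Submodule.mem_span_pair.1 hc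
    rw [qcEuclInner, sum_qcToVec_mul, sum_qcToVec_mul]
    simp only [Prod.smul_mk, Prod.mk_add_mk, smul_eq_mul, (key g12).1 h12, map_zero, mul_zero,
      add_zero, map_mul]
    rw [mul_right_comm, ← mul_assoc, mul_right_comm, mul_assoc a, mul_right_comm, hconj]
    simp

/-- Assume `g` and `l` are self-reciprocal.  If `gcd(t22, g12) ≠ 1` then the
quasi-cyclic code `C = ⟨(g11, g12), (0, g22)⟩` is not Euclidean LCD. -/
theorem stmt6 (F : Type) [Field F] [Fintype F] [DecidableEq F] (m : ℕ) (hm : 0 < m)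
    (hqm : Nat.Coprime (Fintype.card F) m)
    (g11 g12 g22 : F[X])
    (h1 : g11 ∣ X ^ m - 1) (h2 : g22 ∣ X ^ m - 1)
    (h3 : g12.degree < g22.degree) (h4 : g11 * g22 ∣ (X ^ m - 1) * g12)
    (g l g11' g22' r11 t11 r22 t22 : F[X])
    (hg : g = gcd g11 g22) (hl : l = (X ^ m - 1) / lcm g11 g22)
    (h11' : g11' = g11 / g) (h22' : g22' = g22 / g)
    (hr11 : r11 = gcd g11' g11'.reverse) (ht11 : t11 = g11' / r11)
    (hr22 : r22 = gcd g22' g22'.reverse) (ht22 : t22 = g22' / r22)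
    (hsg : IsSelfReciprocal g) (hsl : IsSelfReciprocal l)
    (hne : ¬ IsCoprime t22 g12) :
    ¬ IsLCDWith
      (Submodule.span (AdjoinRoot (X ^ m - 1 : F[X]))
        {(AdjoinRoot.mk (X ^ m - 1 : F[X]) g11, AdjoinRoot.mk (X ^ m - 1 : F[X]) g12), (0, AdjoinRoot.mk (X ^ m - 1 : F[X]) g22)})
      (qcEuclInner hm) := by
  have hm0 : (m : F) ≠ 0 := by
    have h : IsCoprime ((Fintype.card F : ℤ) : F) ((m : ℤ) : F) :=
      (Nat.isCoprime_iff_coprime.2 hqm).map (Int.castRingHom F)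
    simpa using h
  have hsep : (X ^ m - 1 : F[X]).Separable := by
    simpa using separable_X_pow_sub_C (1 : F) hm0 one_ne_zero
  have hX : (X ^ m - 1 : F[X]) ≠ 0 := hsep.ne_zero
  have h220 : g22 ≠ 0 := ne_zero_of_dvd_ne_zero hX h2
  have eg22 : g * g22' = g22 := by
    rw [h22', hg]; exact EuclideanDomain.mul_div_cancel' (gcd_ne_zero_of_right h220) (gcd_dvd_right _ _)
  have h22'0 : g22' ≠ 0 := right_ne_zero_of_mul (eg22 ▸ h220)
  have et22 : r22 * t22 = g22' := by
    rw [ht22, hr22]; exact EuclideanDomain.mul_div_cancel' (gcd_ne_zero_of_left h22'0) (gcd_dvd_left _ _)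
  have hlcm : lcm g11 g22 ∣ X ^ m - 1 := lcm_dvd h1 h2
  have el : lcm g11 g22 * l = X ^ m - 1 := by
    rw [hl]; exact EuclideanDomain.mul_div_cancel' (ne_zero_of_dvd_ne_zero hX hlcm) hlcm
  obtain ⟨θ, ht, h12⟩ : ∃ θ : AlgebraicClosure F, aeval θ t22 = 0 ∧ aeval θ g12 = 0 := by
    by_contra! hc
    exact hne ((isCoprime_iff_aeval_ne_zero_of_isAlgClosed F (AlgebraicClosure F) _ _).2
      fun a => or_iff_not_imp_left.2 fun h => hc a (not_not.1 h))
  have hs22 : g22.Separable := hsep.of_dvd h2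
  have hg22' : aeval θ g22' = 0 := by rw [← et22, map_mul, ht, mul_zero]
  have hg22 : aeval θ g22 = 0 := by rw [← eg22, map_mul, hg22', mul_zero]
  have hgθ : aeval θ g ≠ 0 :=
    Separable.aeval_ne_zero_of_mul (by rwa [mul_comm, eg22]) hg22'
  have hrθ : aeval θ r22 ≠ 0 :=
    Separable.aeval_ne_zero_of_mul
      (by rw [mul_comm, et22]; exact hs22.of_dvd (Dvd.intro_left _ eg22)) ht
  have hlθ : aeval θ l ≠ 0 :=
    Separable.aeval_ne_zero_of_mul (p := lcm g11 g22) (by rwa [el])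
      (aeval_eq_zero_of_dvd_aeval_eq_zero (dvd_lcm_right _ _) hg22)
  have hθ : θ ^ m = 1 := by
    simpa [sub_eq_zero] using aeval_eq_zero_of_dvd_aeval_eq_zero h2 hg22
  have hθ0 : θ ≠ 0 := by
    rintro rfl
    simp [hm.ne'] at hθ
  have h11 : aeval θ g11 ≠ 0 := fun h0 => hgθ <| by
    rw [← minpoly.dvd_iff, hg]
    exact dvd_gcd (minpoly.dvd _ _ h0) (minpoly.dvd _ _ hg22)
  have hinv22' : aeval θ⁻¹ g22' ≠ 0 := fun h0 => hrθ <| by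
    rw [← minpoly.dvd_iff, hr22]
    exact dvd_gcd (minpoly.dvd _ _ hg22') (minpoly.dvd _ _ (aeval_reverse_eq_zero_of_aeval_inv hθ0 h0))
  have hinv : aeval θ⁻¹ (g11 * g22) = 0 := by
    have h0 : aeval θ⁻¹ (lcm g11 g22 * l) = 0 := by simp [el, hθ]
    rw [map_mul] at h0
    exact aeval_eq_zero_of_dvd_aeval_eq_zero
      (lcm_dvd (dvd_mul_right _ _) (dvd_mul_left _ _))
      ((mul_eq_zero.1 h0).resolve_right (hsl.aeval_inv_ne_zero hθ0 hlθ))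
  have hinv11 : aeval θ⁻¹ g11 = 0 := by
    rw [← eg22, map_mul, map_mul] at hinv
    exact (mul_eq_zero.1 hinv).resolve_right
      (mul_ne_zero (hsg.aeval_inv_ne_zero hθ0 hgθ) hinv22')
  exact not_isLCDWith_of_root hm hθ h12 h11 hinv11
end
end
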